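/- Let P be a noiseless, finitely supported probability distribution on 𝒳 × {-1,1}, and partition the support of P_X as 𝒳₊ = {x : P_X(x) > 0, P(Y=1|X=x) = 1} and 𝒳₋ = {x : P_X(x) > 0, P(Y=-1|X=x) = 1}. Suppose f : 𝒳 → [-1,1] is constant on 𝒳₊ with value s₊ and constant on 𝒳₋ with value s₋, where s₊ ≠ s₋. Then H_P(F|Y) = 0 = H_P(F|X), and consequently I_P(F;Y) = I_P(F;X) = H_P(F), so f is a lossless maximal compressor of P. -/

import Mathlib

open Finset

noncomputable section

/-- The binary label space `𝒴 = {-1, 1} ⊆ ℤ`. -/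
abbrev Ybin : Type := ({-1, 1} : Finset ℤ)

/-- The label `+1` as an element of `Ybin`. -/
def yPos : Ybin := ⟨1, by decide⟩

/-- The label `-1` as an element of `Ybin`. -/
def yNeg : Ybin := ⟨-1, by decide⟩

/-- Probability of a set under a finitely supported pmf `P`. -/
def pr {Ω : Type*} [Fintype Ω] (P : Ω → ℝ) (s : Set Ω) : ℝ :=
  ∑ ω, s.indicator P ω

/-- Entropy `H_P(A)` of a random variable `A` (a function of the sample point),
`H_P(A) = -∑_a P(A=a) log P(A=a)`, written as a sum over sample points. -/
def ent {Ω α : Type*} [Fintype Ω] (P : Ω → ℝ) (A : Ω → α) : ℝ :=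
  -∑ ω, P ω * Real.log (pr P {ω' | A ω' = A ω})

/-- Conditional entropy `H_P(A|B) = -∑_{a,b} P(A=a,B=b) log P(A=a|B=b)`. -/
def condEnt {Ω α β : Type*} [Fintype Ω] (P : Ω → ℝ) (A : Ω → α) (B : Ω → β) : ℝ :=
  -∑ ω, P ω * Real.log (pr P {ω' | A ω' = A ω ∧ B ω' = B ω} / pr P {ω' | B ω' = B ω})

/-- Mutual information `I_P(A;B) = ∑_{a,b} P(A=a,B=b) log (P(A=a,B=b) / (P(A=a) P(B=b)))`. -/
def mi {Ω α β : Type*} [Fintype Ω] (P : Ω → ℝ) (A : Ω → α) (B : Ω → β) : ℝ :=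
  ∑ ω, P ω * Real.log (pr P {ω' | A ω' = A ω ∧ B ω' = B ω} /
      (pr P {ω' | A ω' = A ω} * pr P {ω' | B ω' = B ω}))

/-- Marginal `P_X(x) = ∑_y P(x,y)`. -/
def margX {𝒳 : Type*} [Fintype 𝒳] (P : 𝒳 × Ybin → ℝ) (x : 𝒳) : ℝ :=
  ∑ y, P (x, y)

/-- Risk `R_P(h) = P[sign(h(X)) ≠ Y]`. -/
def risk {𝒳 : Type*} [Fintype 𝒳] (P : 𝒳 × Ybin → ℝ) (h : 𝒳 → ℝ) : ℝ :=
  pr P {ω | Real.sign (h ω.1) ≠ ((ω.2 : ℤ) : ℝ)}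


section FinitePmf

variable {Ω α β : Type*} [Fintype Ω] {P : Ω → ℝ}

/-- `A` is `P`-almost surely a function of `B`. -/
def DeterminedBy (P : Ω → ℝ) (A : Ω → α) (B : Ω → β) : Prop :=
  ∀ ω ω', P ω ≠ 0 → P ω' ≠ 0 → B ω' = B ω → A ω' = A ω

lemma pr_congr {s t : Set Ω} (h : ∀ ω, P ω ≠ 0 → (ω ∈ s ↔ ω ∈ t)) : pr P s = pr P t := by
  classical
  refine Finset.sum_congr rfl fun ω _ => ?_
  by_cases h0 : P ω = 0
  · simp [Set.indicator_apply, h0]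
  · simp [Set.indicator_apply, h ω h0]

lemma pr_mono (hP : ∀ ω, 0 ≤ P ω) {s t : Set Ω} (h : s ⊆ t) : pr P s ≤ pr P t :=
  Finset.sum_le_sum fun _ _ => Set.indicator_le_indicator_of_subset h hP _

lemma pr_pos (hP : ∀ ω, 0 ≤ P ω) {s : Set Ω} {ω : Ω} (hω : ω ∈ s) (h0 : P ω ≠ 0) :
    0 < pr P s := by
  refine Finset.sum_pos' (fun i _ => Set.indicator_nonneg (fun _ _ => hP _) i)
    ⟨ω, Finset.mem_univ _, ?_⟩
  rw [Set.indicator_of_mem hω]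
  exact lt_of_le_of_ne (hP ω) h0.symm

lemma pr_fiber_pos (hP : ∀ ω, 0 ≤ P ω) (B : Ω → β) {ω : Ω} (h0 : P ω ≠ 0) :
    0 < pr P {ω' | B ω' = B ω} :=
  pr_pos hP (show B ω = B ω from rfl) h0

lemma pr_lt_pr (hP : ∀ ω, 0 ≤ P ω) {s t : Set Ω} (h : s ⊆ t) {ω : Ω} (hs : ω ∉ s) (ht : ω ∈ t)
    (h0 : P ω ≠ 0) : pr P s < pr P t := by
  refine Finset.sum_lt_sum (fun _ _ => Set.indicator_le_indicator_of_subset h hP _)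
    ⟨ω, Finset.mem_univ _, ?_⟩
  rw [Set.indicator_of_mem ht, Set.indicator_of_notMem hs]
  exact lt_of_le_of_ne (hP ω) h0.symm

lemma DeterminedBy.pr_inter_eq {A : Ω → α} {B : Ω → β} (h : DeterminedBy P A B) {ω : Ω}
    (h0 : P ω ≠ 0) : pr P {ω' | A ω' = A ω ∧ B ω' = B ω} = pr P {ω' | B ω' = B ω} :=
  pr_congr fun ω' h' => ⟨fun hm => hm.2, fun hm => ⟨h ω ω' h0 h' hm, hm⟩⟩

lemma DeterminedBy.condEnt_eq_zero (hP : ∀ ω, 0 ≤ P ω) {A : Ω → α} {B : Ω → β}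
    (h : DeterminedBy P A B) : condEnt P A B = 0 := by
  rw [condEnt, neg_eq_zero]
  refine Finset.sum_eq_zero fun ω _ => ?_
  by_cases h0 : P ω = 0
  · simp [h0]
  · rw [h.pr_inter_eq h0, div_self (pr_fiber_pos hP B h0).ne', Real.log_one, mul_zero]

lemma DeterminedBy.mi_eq_ent (hP : ∀ ω, 0 ≤ P ω) {A : Ω → α} {B : Ω → β}
    (h : DeterminedBy P A B) : mi P A B = ent P A := by
  rw [mi, ent, ← Finset.sum_neg_distrib]
  refine Finset.sum_congr rfl fun ω _ => ?_
  by_cases h0 : P ω = 0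
  · simp [h0]
  · have hB : pr P {ω' | B ω' = B ω} ≠ 0 := (pr_fiber_pos hP B h0).ne'
    rw [h.pr_inter_eq h0, div_mul_cancel_right₀ hB, Real.log_inv, mul_neg]

lemma determinedBy_of_condEnt_eq_zero (hP : ∀ ω, 0 ≤ P ω) {A : Ω → α} {B : Ω → β}
    (h : condEnt P A B = 0) : DeterminedBy P A B := by
  have hsub (ω : Ω) : {ω' | A ω' = A ω ∧ B ω' = B ω} ⊆ {ω' | B ω' = B ω} := fun _ h => h.2
  have hnn (s : Set Ω) : 0 ≤ pr P s :=
    Finset.sum_nonneg fun i _ => Set.indicator_nonneg (fun _ _ => hP _) i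
  rw [condEnt, neg_eq_zero, Finset.sum_eq_zero_iff_of_nonpos fun ω _ =>
    mul_nonpos_of_nonneg_of_nonpos (hP ω) (Real.log_nonpos (div_nonneg (hnn _) (hnn _))
      (div_le_one_of_le₀ (pr_mono hP (hsub ω)) (hnn _)))] at h
  intro ω ω' h0 h0' hB
  by_contra hA
  have hlt : pr P {ω' | A ω' = A ω ∧ B ω' = B ω} < pr P {ω' | B ω' = B ω} :=
    pr_lt_pr hP (hsub ω) (fun hm => hA hm.1) hB h0'
  have hpos : 0 < pr P {ω' | A ω' = A ω ∧ B ω' = B ω} := pr_pos hP ⟨rfl, rfl⟩ h0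
  have hlog := Real.log_neg (div_pos hpos (hpos.trans hlt))
    ((div_lt_one (hpos.trans hlt)).2 hlt)
  exact (mul_ne_zero h0 hlog.ne) (h ω (Finset.mem_univ _))

lemma mi_comm (A : Ω → α) (B : Ω → β) : mi P A B = mi P B A := by
  simp only [mi, and_comm, mul_comm (pr P {ω' | A ω' = A _})]

lemma ent_eq_of_determinedBy {A : Ω → α} {B : Ω → β} (hAB : DeterminedBy P A B)
    (hBA : DeterminedBy P B A) : ent P A = ent P B := by
  rw [ent, ent, neg_inj]
  refine Finset.sum_congr rfl fun ω _ => ?_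
  by_cases h0 : P ω = 0
  · simp [h0]
  · congr 2
    exact pr_congr fun ω' h' => ⟨hBA ω ω' h0 h', hAB ω ω' h0 h'⟩

end FinitePmf

lemma margX_eq_of_determinedBy {𝒳 : Type*} [Fintype 𝒳] {P : 𝒳 × Ybin → ℝ}
    (h : DeterminedBy P (fun ω => ω.2) (fun ω => ω.1)) {x : 𝒳} {y : Ybin} (h0 : P (x, y) ≠ 0) :
    margX P x = P (x, y) := by
  refine Finset.sum_eq_single y (fun y' _ hy => ?_) (fun hy => absurd (Finset.mem_univ _) hy)
  by_contra h'
  exact hy (h (x, y) (x, y') h0 h' rfl)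

lemma Ybin.eq_yPos_or_eq_yNeg (y : Ybin) : y = yPos ∨ y = yNeg := by
  revert y
  decide

/-- Let `P` be noiseless with `𝒳₊, 𝒳₋` as before. If `f : 𝒳 → [-1,1]` is
constant `s₊` on `𝒳₊` and constant `s₋` on `𝒳₋` with `s₊ ≠ s₋`, then
`H_P(F|Y) = 0 = H_P(F|X)`, `I_P(F;Y) = I_P(F;X) = H_P(F)`, and `f` is a lossless maximal
compressor of `P`. -/
theorem two_valued_is_lmc {𝒳 : Type*} [Fintype 𝒳]
    (P : 𝒳 × Ybin → ℝ) (hP0 : ∀ ω, 0 ≤ P ω) (hP1 : ∑ ω, P ω = 1)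
    (hnoiseless : condEnt P (fun ω => ω.2) (fun ω => ω.1) = 0)
    (f : 𝒳 → ℝ) (hf : ∀ x, f x ∈ Set.Icc (-1 : ℝ) 1)
    (sp sm : ℝ) (hsp : sp ∈ Set.Icc (-1 : ℝ) 1) (hsm : sm ∈ Set.Icc (-1 : ℝ) 1)
    (hne : sp ≠ sm)
    (hfp : ∀ x : 𝒳, 0 < margX P x → P (x, yPos) / margX P x = 1 → f x = sp)
    (hfm : ∀ x : 𝒳, 0 < margX P x → P (x, yNeg) / margX P x = 1 → f x = sm) :
    condEnt P (fun ω => f ω.1) (fun ω => ω.2) = 0 ∧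
    condEnt P (fun ω => f ω.1) (fun ω => ω.1) = 0 ∧
    mi P (fun ω => f ω.1) (fun ω => ω.2) = ent P (fun ω => f ω.1) ∧
    mi P (fun ω => f ω.1) (fun ω => ω.1) = ent P (fun ω => f ω.1) ∧
    mi P (fun ω => f ω.1) (fun ω => ω.1) = mi P (fun ω => f ω.1) (fun ω => ω.2) ∧
    mi P (fun ω => f ω.1) (fun ω => ω.2) = mi P (fun ω => ω.1) (fun ω => ω.2) := by
  have hYX := determinedBy_of_condEnt_eq_zero hP0 hnoiseless
  have hval : ∀ ω : 𝒳 × Ybin, P ω ≠ 0 → f ω.1 = if ω.2 = yPos then sp else sm := by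
    rintro ⟨x, y⟩ h0
    have hm := margX_eq_of_determinedBy hYX h0
    have hpos : 0 < margX P x := hm ▸ lt_of_le_of_ne (hP0 _) h0.symm
    have hone : P (x, y) / margX P x = 1 := by rw [hm, div_self h0]
    rcases Ybin.eq_yPos_or_eq_yNeg y with rfl | rfl
    · simpa using hfp x hpos hone
    · simpa [show yNeg ≠ yPos by decide] using hfm x hpos hone
  have hFY : DeterminedBy P (fun ω => f ω.1) (fun ω => ω.2) := by
    intro ω ω' h0 h0' h
    simp only [hval ω h0, hval ω' h0', h]
  have hYF : DeterminedBy P (fun ω => ω.2) (fun ω => f ω.1) := by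
    intro ω ω' h0 h0' h
    simp only [hval ω h0, hval ω' h0'] at h
    rcases Ybin.eq_yPos_or_eq_yNeg ω.2 with h1 | h1 <;>
      rcases Ybin.eq_yPos_or_eq_yNeg ω'.2 with h2 | h2 <;>
      simp_all [show yNeg ≠ yPos by decide, eq_comm]
  have hFX : DeterminedBy P (fun ω => f ω.1) (fun ω => ω.1) :=
    fun _ _ _ _ h => congrArg f h
  have hmiY := hFY.mi_eq_ent hP0
  have hmiX := hFX.mi_eq_ent hP0
  refine ⟨hFY.condEnt_eq_zero hP0, hFX.condEnt_eq_zero hP0, hmiY, hmiX,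
    hmiX.trans hmiY.symm, ?_⟩
  rw [hmiY, mi_comm, hYX.mi_eq_ent hP0, ent_eq_of_determinedBy hFY hYF]
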